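/- Let Λ be a lattice in ℝ^n, let Q be a positive definite symmetric bilinear form on ℝ^n that is integral with respect to Λ, fix r ∈ ℝ^n, and let B ⊂ ℤ^n be a complete set of representatives of the quotient group ℤ^n/q(Λ) (which is finite since Q is positive definite). Then every theta function Θ for (Q, Q(·,r)) can be written as Θ(x) = max_{b∈B}(Θ_b(x) + s_b) for all x ∈ ℝ^n, where s_b = −Θ̂(b) + (1/2)Q(v_b−r, v_b−r) ∈ ℝ for each b ∈ B. -/

import Mathlib

noncomputable section

/-- Standard inner product on ℝ^n. -/
def dotp {n : ℕ} (a x : Fin n → ℝ) : ℝ := ∑ i, a i * x i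

/-- Λ is a (full-rank) lattice in ℝ^n. -/
def IsLattice {n : ℕ} (Λ : Set (Fin n → ℝ)) : Prop :=
  ∃ e : Module.Basis (Fin n) ℝ (Fin n → ℝ),
    Λ = {x | ∃ c : Fin n → ℤ, x = ∑ i, (c i : ℝ) • e i}

/-- Q is a symmetric bilinear form. -/
def IsSymmBilin {n : ℕ} (Q : (Fin n → ℝ) → (Fin n → ℝ) → ℝ) : Prop :=
  (∀ x, IsLinearMap ℝ (Q x)) ∧ ∀ x y, Q x y = Q y x

/-- Quasi-periodicity condition for (Q, α). -/
def QuasiPeriodic {n : ℕ} (Λ : Set (Fin n → ℝ))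
    (Q : (Fin n → ℝ) → (Fin n → ℝ) → ℝ) (α : (Fin n → ℝ) → ℝ)
    (Θ : (Fin n → ℝ) → ℝ) : Prop :=
  ∀ l ∈ Λ, ∀ x, Θ (x + l) = Θ x + Q l x + (1/2) * Q l l + α l

/-- Θ is regular: locally a max of finitely many affine functions with integral slopes. -/
def RegularFn {n : ℕ} (Θ : (Fin n → ℝ) → ℝ) : Prop :=
  ∀ x : Fin n → ℝ, ∃ U ∈ nhds x, ∃ (k : ℕ) (a : Fin (k+1) → Fin n → ℤ) (c : Fin (k+1) → ℝ),
    ∀ y ∈ U, Θ y = Finset.univ.sup' Finset.univ_nonempty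
      (fun i => dotp (fun j => (a i j : ℝ)) y + c i)

/-- A theta function for (Q, α): convex, regular, quasi-periodic. -/
def IsThetaFn {n : ℕ} (Λ : Set (Fin n → ℝ))
    (Q : (Fin n → ℝ) → (Fin n → ℝ) → ℝ) (α : (Fin n → ℝ) → ℝ)
    (Θ : (Fin n → ℝ) → ℝ) : Prop :=
  ConvexOn ℝ Set.univ Θ ∧ RegularFn Θ ∧ QuasiPeriodic Λ Q α Θ

/-- Q is integral with respect to Λ. -/
def IntegralWrt {n : ℕ} (Q : (Fin n → ℝ) → (Fin n → ℝ) → ℝ) (Λ : Set (Fin n → ℝ)) : Prop :=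
  ∀ l ∈ Λ, ∀ m : Fin n → ℤ, ∃ k : ℤ, Q l (fun i => (m i : ℝ)) = (k : ℝ)

/-- m lies in q(Λ): ⟨m,x⟩ = Q(λ,x) for some λ ∈ Λ and all x. -/
def InQLat {n : ℕ} (Λ : Set (Fin n → ℝ)) (Q : (Fin n → ℝ) → (Fin n → ℝ) → ℝ)
    (m : Fin n → ℝ) : Prop :=
  ∃ l ∈ Λ, ∀ x, dotp m x = Q l x

/-- The generator Θ_b (with v_b passed as `vb`). -/
def ThetaGen {n : ℕ} (Λ : Set (Fin n → ℝ)) (Q : (Fin n → ℝ) → (Fin n → ℝ) → ℝ)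
    (r vb : Fin n → ℝ) (b : Fin n → ℤ) (x : Fin n → ℝ) : ℝ :=
  sSup {t | ∃ l ∈ Λ, t = dotp (fun i => (b i : ℝ)) x + Q l x
      - (1/2) * Q (l + vb - r) (l + vb - r)}

/-- The Legendre transform of Θ. -/
def legendreT {n : ℕ} (Θ : (Fin n → ℝ) → ℝ) (a : Fin n → ℝ) : ℝ :=
  sSup {t | ∃ x, t = dotp a x - Θ x}

/-- The generator Θ_b, with v_b obtained from the duality map v. -/
def thetaGenOf {n : ℕ} (Λ : Set (Fin n → ℝ)) (Q : (Fin n → ℝ) → (Fin n → ℝ) → ℝ)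
    (r : Fin n → ℝ) (v : (Fin n → ℝ) → (Fin n → ℝ)) (b : Fin n → ℤ) :
    (Fin n → ℝ) → ℝ :=
  ThetaGen Λ Q r (v (fun i => (b i : ℝ))) b

/-- φ^b(Θ) = inf_y (Θ(y) − Θ_b(y)). -/
def phiB {n : ℕ} (Λ : Set (Fin n → ℝ)) (Q : (Fin n → ℝ) → (Fin n → ℝ) → ℝ)
    (r : Fin n → ℝ) (v : (Fin n → ℝ) → (Fin n → ℝ)) (b : Fin n → ℤ)
    (Θ : (Fin n → ℝ) → ℝ) : ℝ :=
  sInf {u | ∃ y, u = Θ y - thetaGenOf Λ Q r v b y}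

/-- The coordinate set S ⊂ ℝ^B of tuples (φ^b(Θ))_{b∈B} for theta functions Θ. -/
def thetaCoordSet {n : ℕ} (Λ : Set (Fin n → ℝ)) (Q : (Fin n → ℝ) → (Fin n → ℝ) → ℝ)
    (r : Fin n → ℝ) (v : (Fin n → ℝ) → (Fin n → ℝ)) (B : Finset (Fin n → ℤ)) :
    Set ({b // b ∈ B} → ℝ) :=
  {t | ∃ Θ, IsThetaFn Λ Q (fun x => Q x r) Θ ∧
      ∀ b : {b // b ∈ B}, t b = phiB Λ Q r v b.1 Θ}

/-- Ξ(x) = sup over a ∈ ℤ^n of (⟨a,x⟩ − ½ Q(v_a−r, v_a−r)). -/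
def XiFn {n : ℕ} (Q : (Fin n → ℝ) → (Fin n → ℝ) → ℝ) (v : (Fin n → ℝ) → (Fin n → ℝ))
    (r : Fin n → ℝ) (x : Fin n → ℝ) : ℝ :=
  sSup {t | ∃ a : Fin n → ℤ, t = dotp (fun i => (a i : ℝ)) x
      - (1/2) * Q (v (fun i => (a i : ℝ)) - r) (v (fun i => (a i : ℝ)) - r)}


theorem aux_Qcont {n : ℕ} (Q : (Fin n → ℝ) → (Fin n → ℝ) → ℝ) (hQ : IsSymmBilin Q) :
    Continuous (fun x => Q x x) := by
  have hlin : ∀ z, Continuous (Q z) := fun z =>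
    ((hQ.1 z).mk' (Q z)).continuous_of_finiteDimensional
  have h : (fun x => Q x x) = fun x : Fin n → ℝ => ∑ i, x i * Q (Pi.single i 1) x := by
    funext x
    have h1 : Q x x = ((hQ.1 x).mk' (Q x)) x := rfl
    rw [h1, LinearMap.pi_apply_eq_sum_univ ((hQ.1 x).mk' (Q x)) x]
    refine Finset.sum_congr rfl fun i _ => ?_
    have h2 : (fun j => if i = j then (1 : ℝ) else 0) = Pi.single i 1 := by
      funext j
      simp [Pi.single_apply, eq_comm]
    rw [h2, hQ.2 (Pi.single i 1) x]
    simp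
  rw [h]
  exact continuous_finsetSum _ fun i _ => (continuous_apply i).mul (hlin _)

theorem aux_bdd {n : ℕ} (Λ : Set (Fin n → ℝ)) (hΛ : IsLattice Λ) (f : (Fin n → ℝ) → ℝ)
    (hf : Continuous f) (hper : ∀ l ∈ Λ, ∀ x, f (x + l) = f x) :
    ∃ C, ∀ x, C ≤ f x := by
  obtain ⟨e, rfl⟩ := hΛ
  have hg : Continuous (fun c : Fin n → ℝ => ∑ i, c i • e i) :=
    continuous_finsetSum _ fun i _ => (continuous_apply i).smul continuous_const
  have hK : IsCompact ((fun c : Fin n → ℝ => ∑ i, c i • e i) '' (Set.Icc 0 1)) :=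
    isCompact_Icc.image hg
  obtain ⟨C, hC⟩ := (hK.image hf).bddBelow
  refine ⟨C, fun x => ?_⟩
  have hx : x = (∑ i, Int.fract (e.repr x i) • e i) + ∑ i, ((⌊e.repr x i⌋ : ℤ) : ℝ) • e i := by
    conv_lhs => rw [← e.sum_repr x]
    rw [← Finset.sum_add_distrib]
    refine Finset.sum_congr rfl fun i _ => ?_
    rw [← add_smul, Int.fract_add_floor]
  rw [hx, hper _ ⟨_, rfl⟩]
  refine hC ⟨_, ⟨fun i => Int.fract (e.repr x i), ⟨fun i => ?_, fun i => ?_⟩, rfl⟩, rfl⟩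
  · exact Int.fract_nonneg _
  · exact (Int.fract_lt_one _).le

theorem dotp_add {n : ℕ} (a x y : Fin n → ℝ) : dotp a (x + y) = dotp a x + dotp a y := by
  simp [dotp, mul_add, Finset.sum_add_distrib]

theorem dotp_smul {n : ℕ} (a x : Fin n → ℝ) (c : ℝ) : dotp a (c • x) = c * dotp a x := by
  simp [dotp, Finset.mul_sum, mul_left_comm]

theorem aux_support {n : ℕ} (Θ : (Fin n → ℝ) → ℝ) (hc : ConvexOn ℝ Set.univ Θ)
    (hr : RegularFn Θ) (x : Fin n → ℝ) :
    ∃ a : Fin n → ℤ, ∀ y, Θ x - dotp (fun j => (a j : ℝ)) x ≤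
      Θ y - dotp (fun j => (a j : ℝ)) y := by
  obtain ⟨U, hU, k, a, c, h⟩ := hr x
  obtain ⟨i, -, hi⟩ := Finset.exists_mem_eq_sup' (Finset.univ_nonempty (α := Fin (k+1)))
    (fun i => dotp (fun j => (a i j : ℝ)) x + c i)
  refine ⟨a i, ?_⟩
  have hxe : Θ x = dotp (fun j => (a i j : ℝ)) x + c i := by
    rw [h x (mem_of_mem_nhds hU), hi]
  have hconv : ConvexOn ℝ Set.univ (fun y => Θ y - dotp (fun j => (a i j : ℝ)) y) := by
    refine ⟨convex_univ, fun p _ q _ s t hs ht hst => ?_⟩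
    have := hc.2 (Set.mem_univ p) (Set.mem_univ q) hs ht hst
    simp only [dotp_add, dotp_smul, smul_eq_mul] at this ⊢
    linarith
  refine IsMinOn.of_isLocalMin_of_convex_univ ?_ hconv
  filter_upwards [hU] with y hy
  have h2 : dotp (fun j => (a i j : ℝ)) y + c i ≤ Θ y := by
    rw [h y hy]
    exact Finset.le_sup' (fun i => dotp (fun j => (a i j : ℝ)) y + c i) (Finset.mem_univ i)
  linarith

theorem stmt6 {n : ℕ} (Λ : Set (Fin n → ℝ)) (hΛ : IsLattice Λ)
    (Q : (Fin n → ℝ) → (Fin n → ℝ) → ℝ) (hQ : IsSymmBilin Q)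
    (hpos : ∀ x : Fin n → ℝ, x ≠ 0 → 0 < Q x x) (hint : IntegralWrt Q Λ)
    (r : Fin n → ℝ) (v : (Fin n → ℝ) → (Fin n → ℝ))
    (hv : ∀ a x, Q (v a) x = dotp a x)
    (B : Finset (Fin n → ℤ))
    (hB : ∀ m : Fin n → ℤ, ∃! b, b ∈ B ∧
      InQLat Λ Q (fun i => (m i : ℝ) - (b i : ℝ)))
    (Θ : (Fin n → ℝ) → ℝ) (hΘ : IsThetaFn Λ Q (fun x => Q x r) Θ) :
    ∀ x : Fin n → ℝ,
      IsGreatest {t | ∃ b ∈ B, t = thetaGenOf Λ Q r v b x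
        + (-(legendreT Θ (fun i => (b i : ℝ)))
          + (1/2) * Q (v (fun i => (b i : ℝ)) - r) (v (fun i => (b i : ℝ)) - r))} (Θ x) := by
  obtain ⟨hc, hr, hq⟩ := hΘ
  have radd : ∀ x y z, Q x (y + z) = Q x y + Q x z := fun x y z => (hQ.1 x).map_add y z
  have rsub : ∀ x y z, Q x (y - z) = Q x y - Q x z := fun x y z => (hQ.1 x).map_sub y z
  have ladd : ∀ x y z, Q (x + y) z = Q x z + Q y z := fun x y z => by
    rw [hQ.2, radd, hQ.2 z x, hQ.2 z y]
  have lsub : ∀ x y z, Q (x - y) z = Q x z - Q y z := fun x y z => by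
    rw [hQ.2, rsub, hQ.2 z x, hQ.2 z y]
  have hnn : ∀ x, 0 ≤ Q x x := fun x => by
    by_cases h : x = 0
    · subst h
      exact ((hQ.1 0).map_zero).ge
    · exact (hpos x h).le
  have hΘc : Continuous Θ := by
    have := hc.continuousOn_interior
    rwa [interior_univ, continuousOn_univ] at this
  have hrc : Continuous (fun x => Q x r) := by
    have h : (fun x => Q x r) = Q r := funext fun x => hQ.2 x r
    rw [h]
    exact ((hQ.1 r).mk' (Q r)).continuous_of_finiteDimensional
  obtain ⟨C, hC⟩ := aux_bdd Λ hΛ (fun x => Θ x - (1/2) * Q x x - Q x r)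
    ((hΘc.sub (continuous_const.mul (aux_Qcont Q hQ))).sub hrc) (by
      intro l hl x
      have h1 := hq l hl x
      simp only [radd, ladd, h1]
      rw [hQ.2 x l]
      ring)
  have hbdd : ∀ a, BddAbove {t | ∃ x, t = dotp a x - Θ x} := by
    intro a
    refine ⟨(1/2) * Q (v a - r) (v a - r) - C, ?_⟩
    rintro t ⟨x, rfl⟩
    have h1 := hC x
    have h2 := hnn (v a - r - x)
    have h3 := hv a x
    simp only [rsub, lsub] at h1 h2 ⊢
    rw [hQ.2 x (v a), hQ.2 r (v a), hQ.2 x r] at h2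
    rw [hQ.2 x r] at h1
    rw [hQ.2 r (v a)]
    linarith
  have hfen : ∀ a x, dotp a x - Θ x ≤ legendreT Θ a := fun a x => le_csSup (hbdd a) ⟨x, rfl⟩
  intro x
  have key : ∀ b : Fin n → ℤ, ∀ l ∈ Λ,
      dotp (fun i => (b i : ℝ)) x + Q l x
      - (1/2) * Q (l + v (fun i => (b i : ℝ)) - r) (l + v (fun i => (b i : ℝ)) - r) ≤
      Θ x - (-(legendreT Θ (fun i => (b i : ℝ)))
          + (1/2) * Q (v (fun i => (b i : ℝ)) - r) (v (fun i => (b i : ℝ)) - r)) := by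
    intro b l hl
    generalize (fun i => (b i : ℝ)) = a
    have h1 := hfen a (x - l)
    have h2 := hq l hl (x - l)
    rw [sub_add_cancel] at h2
    rw [← hv, rsub, hv] at h1
    simp only [rsub, lsub, radd, ladd] at h1 h2 ⊢
    rw [hQ.2 (v a) l] at h1
    rw [hQ.2 (v a) l, hQ.2 r l]
    linarith
  obtain ⟨l0, hl0⟩ : ∃ l, l ∈ Λ := by
    obtain ⟨e, rfl⟩ := hΛ
    exact ⟨_, 0, rfl⟩
  have hub : ∀ b : Fin n → ℤ, thetaGenOf Λ Q r v b x ≤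
      Θ x - (-(legendreT Θ (fun i => (b i : ℝ)))
          + (1/2) * Q (v (fun i => (b i : ℝ)) - r) (v (fun i => (b i : ℝ)) - r)) := by
    intro b
    refine csSup_le ⟨_, l0, hl0, rfl⟩ ?_
    rintro t ⟨l, hl, rfl⟩
    exact key b l hl
  refine ⟨?_, ?_⟩
  · obtain ⟨m, hm⟩ := aux_support Θ hc hr x
    obtain ⟨b, ⟨hbB, l, hl, hbl⟩, -⟩ := hB m
    refine ⟨b, hbB, le_antisymm ?_ (by linarith [hub b])⟩
    have hle : dotp (fun i => (b i : ℝ)) x + Q l x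
      - (1/2) * Q (l + v (fun i => (b i : ℝ)) - r) (l + v (fun i => (b i : ℝ)) - r) ≤
        thetaGenOf Λ Q r v b x := by
      refine le_csSup ⟨Θ x - (-(legendreT Θ (fun i => (b i : ℝ)))
          + (1/2) * Q (v (fun i => (b i : ℝ)) - r) (v (fun i => (b i : ℝ)) - r)), ?_⟩ ⟨l, hl, rfl⟩
      rintro t ⟨l, hl, rfl⟩
      exact key b l hl
    have hmb : ∀ y, dotp (fun i => (m i : ℝ)) y = dotp (fun i => (b i : ℝ)) y + Q l y := by
      intro y
      rw [← hbl y]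
      simp only [dotp, ← Finset.sum_add_distrib]
      exact Finset.sum_congr rfl fun i _ => by ring
    simp only [hmb] at hm
    revert hle hm
    generalize thetaGenOf Λ Q r v b x = G
    generalize (fun i => (b i : ℝ)) = a
    intro hle hm
    have hT : legendreT Θ a ≤ dotp a x + Q l x - Θ x - (1/2) * Q l l - Q l (v a) + Q l r := by
      refine csSup_le ⟨_, 0, rfl⟩ ?_
      rintro t ⟨y, rfl⟩
      have h1 := hm (y + l)
      have h2 := hq l hl y
      have h3 := hv a l
      rw [hQ.2 (v a) l] at h3
      rw [dotp_add, radd] at h1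
      linarith
    simp only [rsub, lsub, radd, ladd] at hle ⊢
    rw [hQ.2 (v a) l, hQ.2 r l] at hle
    linarith
  · rintro t ⟨b, -, rfl⟩
    linarith [hub b]
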